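/- arXiv:1905.12205 — 5 statements merged into one kernel-verified Lean document; each statement's English description precedes it below -/
import Mathlib

section
/- Let G be a finite group, σ : G → G a group automorphism, (π, V) an irreducible finite-dimensional complex representation of G, and I : V → V a linear map with I ∘ π(g) = π(σ(g)) ∘ I for all g ∈ G. Let X_σ = {h σ(h)⁻¹ : h ∈ G} be the σ-conjugacy class of the identity. Then for every vector v ∈ V with I(v) = v and every linear functional Λ : V → ℂ, one has Σ_{g ∈ X_σ} Λ(π(g) v) = (|X_σ| · trace(I) / dim V) · Λ(v). -/
/-- Let `G` be a finite group, `σ` an automorphism, `π` an irreducible finite-dimensional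
complex representation of `G` on `V`, and `I` a linear map with `I ∘ π(g) = π(σ g) ∘ I`.
Let `X_σ = {h σ(h)⁻¹ : h ∈ G}`. Then for every vector `v` with `I v = v` and every linear
functional `Λ`, one has `Σ_{g ∈ X_σ} Λ(π(g) v) = (|X_σ| · trace I / dim V) · Λ(v)`. -/
theorem stmt4 {G : Type*} [Group G] [Fintype G] (σ : G ≃* G)
    {V : Type*} [AddCommGroup V] [Module ℂ V] [FiniteDimensional ℂ V]
    (π : Representation ℂ G V) (I : V →ₗ[ℂ] V)
    (hI : ∀ g : G, I ∘ₗ π g = π (σ g) ∘ₗ I)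
    (hnz : ∃ v : V, v ≠ 0)
    (hirr : ∀ W : Submodule ℂ V, (∀ g : G, ∀ w ∈ W, π g w ∈ W) → W = ⊥ ∨ W = ⊤)
    (Xσ : Finset G) (hXσ : ∀ x : G, x ∈ Xσ ↔ ∃ h : G, x = h * (σ h)⁻¹)
    (v : V) (hv : I v = v) (Λ : V →ₗ[ℂ] ℂ) :
    ∑ g ∈ Xσ, Λ (π g v) =
      ((Xσ.card : ℂ) * LinearMap.trace ℂ V I / (Module.finrank ℂ V : ℂ)) * Λ v := by
  classical
  obtain ⟨w₀, hw₀⟩ := hnz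
  haveI : Nontrivial V := ⟨⟨w₀, 0, hw₀⟩⟩
  have hIa : ∀ (g : G) (w : V), I (π g w) = π (σ g) (I w) := fun g w =>
    LinearMap.congr_fun (hI g) w
  have hmul : ∀ (a b : G) (w : V), π a (π b w) = π (a * b) w := fun a b w => by
    rw [map_mul]; rfl
  let T : Module.End ℂ V := ∑ x ∈ Xσ, π x ∘ₗ I
  have hTa : ∀ w, T w = ∑ x ∈ Xσ, π x (I w) := fun w => by
    simp [T, LinearMap.sum_apply]
  have hcomm : ∀ (g : G) (w : V), T (π g w) = π g (T w) := by
    intro g w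
    rw [hTa, hTa, map_sum]
    symm
    refine Finset.sum_bij' (fun x _ => g * x * (σ g)⁻¹) (fun x _ => g⁻¹ * x * σ g) ?_ ?_ ?_ ?_ ?_
    · intro x hx
      obtain ⟨h, rfl⟩ := (hXσ x).1 hx
      exact (hXσ _).2 ⟨g * h, by simp [mul_assoc]⟩
    · intro x hx
      obtain ⟨h, rfl⟩ := (hXσ x).1 hx
      exact (hXσ _).2 ⟨g⁻¹ * h, by simp [mul_assoc]⟩
    · intro x _
      simp [mul_assoc]
    · intro x _
      simp [mul_assoc]
    · intro x _
      rw [hIa, hmul, hmul]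
      simp [mul_assoc]
  obtain ⟨c, hc⟩ := Module.End.exists_eigenvalue T
  have htop : Module.End.eigenspace T c = ⊤ := by
    rcases hirr (Module.End.eigenspace T c) (fun g w hw => by
      rw [Module.End.mem_eigenspace_iff] at hw ⊢
      rw [hcomm, hw, map_smul]) with h | h
    · exact absurd h hc
    · exact h
  have hTc : ∀ w, T w = c • w := fun w => by
    have : w ∈ Module.End.eigenspace T c := htop ▸ Submodule.mem_top
    exact Module.End.mem_eigenspace_iff.1 this
  have htr1 : LinearMap.trace ℂ V T = c * (Module.finrank ℂ V : ℂ) := by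
    have : T = c • LinearMap.id := LinearMap.ext fun w => by simp [hTc]
    rw [this, map_smul, LinearMap.trace_id, smul_eq_mul]
  have htr2 : LinearMap.trace ℂ V T = (Xσ.card : ℂ) * LinearMap.trace ℂ V I := by
    have : ∀ x ∈ Xσ, LinearMap.trace ℂ V (π x ∘ₗ I) = LinearMap.trace ℂ V I := by
      intro x hx
      obtain ⟨h, rfl⟩ := (hXσ x).1 hx
      have e : π (h * (σ h)⁻¹) ∘ₗ I = π h ∘ₗ (I ∘ₗ π h⁻¹) := by
        ext w
        simp only [LinearMap.comp_apply]
        rw [hIa, hmul, map_inv]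
      have e2 : (I ∘ₗ π h⁻¹) ∘ₗ π h = I := by
        ext w
        simp only [LinearMap.comp_apply]
        rw [hmul]; simp
      rw [e, LinearMap.trace_comp_comm', e2]
    simp only [T, map_sum]
    rw [Finset.sum_congr rfl this]
    simp
  have hd : (Module.finrank ℂ V : ℂ) ≠ 0 := by
    exact_mod_cast (Module.finrank_pos (R := ℂ) (M := V)).ne'
  rw [← htr2, htr1, mul_div_cancel_right₀ _ hd, ← map_sum]
  have := hTc v
  rw [hTa, hv] at this
  rw [this, map_smul, smul_eq_mul]
end

section
/- Let G be a finite group and σ : G → G a group automorphism with σ ∘ σ = id. Let (π, V) be an irreducible finite-dimensional complex representation of G such that π is σ-invariant, i.e. there exists an invertible linear map J : V → V with J ∘ π(g) = π(σ(g)) ∘ J for all g ∈ G. Then there exists a linear map I : V → V satisfying I ∘ π(g) = π(σ(g)) ∘ I for all g ∈ G and I ∘ I = id_V; moreover there are exactly two such maps, and they differ by a sign (if I is one, the other is −I). -/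
/-- Schur's lemma: an endomorphism commuting with an irreducible representation is a scalar. -/
theorem schur_scalar {G : Type*} [Group G]
    {V : Type*} [AddCommGroup V] [Module ℂ V] [FiniteDimensional ℂ V]
    (π : Representation ℂ G V)
    (hnz : ∃ v : V, v ≠ 0)
    (hirr : ∀ W : Submodule ℂ V, (∀ g : G, ∀ w ∈ W, π g w ∈ W) → W = ⊥ ∨ W = ⊤)
    (T : V →ₗ[ℂ] V) (hT : ∀ g v, T (π g v) = π g (T v)) : ∃ c : ℂ, ∀ v, T v = c • v := by
  obtain ⟨v, hv⟩ := hnz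
  haveI : Nontrivial V := ⟨v, 0, hv⟩
  obtain ⟨c, hc⟩ := Module.End.exists_eigenvalue T
  refine ⟨c, fun w => ?_⟩
  rcases hirr (Module.End.eigenspace T c) (fun g w hw => by
    rw [Module.End.mem_eigenspace_iff] at hw ⊢
    rw [hT, hw, map_smul]) with h | h
  · exact absurd h hc
  · have : w ∈ Module.End.eigenspace T c := by rw [h]; trivial
    exact Module.End.mem_eigenspace_iff.1 this

/-- Let `G` be a finite group and `σ` an automorphism with `σ ∘ σ = id`. Let `π` be an
irreducible finite-dimensional complex representation of `G` on `V` which is `σ`-invariant,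
i.e. there is an invertible linear map `J` with `J ∘ π(g) = π(σ g) ∘ J` for all `g`.
Then there is a linear map `I` intertwining `π` with its `σ`-twist with `I ∘ I = id`;
moreover there are exactly two such maps, differing by a sign. -/
theorem stmt5 {G : Type*} [Group G] [Finite G] (σ : G ≃* G)
    (hσ : ∀ g : G, σ (σ g) = g)
    {V : Type*} [AddCommGroup V] [Module ℂ V] [FiniteDimensional ℂ V]
    (π : Representation ℂ G V)
    (hnz : ∃ v : V, v ≠ 0)
    (hirr : ∀ W : Submodule ℂ V, (∀ g : G, ∀ w ∈ W, π g w ∈ W) → W = ⊥ ∨ W = ⊤)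
    (hinv : ∃ J : V ≃ₗ[ℂ] V,
      ∀ g : G, J.toLinearMap ∘ₗ π g = π (σ g) ∘ₗ J.toLinearMap) :
    ∃ I : V →ₗ[ℂ] V,
      (∀ g : G, I ∘ₗ π g = π (σ g) ∘ₗ I) ∧ I ∘ₗ I = LinearMap.id ∧
      (∀ g : G, (-I) ∘ₗ π g = π (σ g) ∘ₗ (-I)) ∧ (-I) ∘ₗ (-I) = LinearMap.id ∧
      I ≠ -I ∧
      (∀ I' : V →ₗ[ℂ] V,
        (∀ g : G, I' ∘ₗ π g = π (σ g) ∘ₗ I') → I' ∘ₗ I' = LinearMap.id →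
          I' = I ∨ I' = -I) := by
  obtain ⟨J, hJ⟩ := hinv
  have hJ' : ∀ g v, J (π g v) = π (σ g) (J v) := fun g v => LinearMap.congr_fun (hJ g) v
  obtain ⟨c, hc⟩ := schur_scalar π hnz hirr (J.toLinearMap ∘ₗ J.toLinearMap)
    (fun g v => by simp [hJ', hσ])
  have hc' : ∀ v, J (J v) = c • v := hc
  obtain ⟨v₀, hv₀⟩ := hnz
  have hc0 : c ≠ 0 := by
    rintro rfl
    have h := hc' v₀
    rw [zero_smul] at h
    exact hv₀ (by simpa using h)
  obtain ⟨d, hd⟩ := IsAlgClosed.exists_pow_nat_eq c (n := 2) (by norm_num)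
  have hd0 : d ≠ 0 := by
    rintro rfl
    exact hc0 (by simpa using hd.symm)
  obtain ⟨I, hI⟩ : ∃ I : V →ₗ[ℂ] V, I = d⁻¹ • J.toLinearMap := ⟨_, rfl⟩
  have hIg : ∀ g v, I (π g v) = π (σ g) (I v) := fun g v => by simp [hI, hJ']
  have hII : ∀ v, I (I v) = v := fun v => by
    simp only [hI, LinearMap.smul_apply, map_smul, LinearEquiv.coe_coe, hc', smul_smul, ← hd]
    have : d⁻¹ * (d⁻¹ * d ^ 2) = 1 := by field_simp
    rw [this, one_smul]
  refine ⟨I, fun g => LinearMap.ext (hIg g), LinearMap.ext hII, fun g => ?_, ?_, ?_, ?_⟩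
  · ext v; simp [hIg]
  · ext v; simp [hII]
  · intro h
    have h1 : I v₀ = -I v₀ := LinearMap.congr_fun h v₀
    have h2 : (2 : ℂ) • I v₀ = 0 := by
      rw [two_smul]
      nth_rewrite 1 [h1]
      exact neg_add_cancel _
    have h3 : I v₀ = 0 := (smul_eq_zero.1 h2).resolve_left two_ne_zero
    apply hv₀
    rw [← hII v₀, h3, map_zero]
  · intro I' h1 h2
    have h1' : ∀ g v, I' (π g v) = π (σ g) (I' v) := fun g v => LinearMap.congr_fun (h1 g) v
    have h2' : ∀ v, I' (I' v) = v := fun v => LinearMap.congr_fun h2 v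
    obtain ⟨e, he⟩ := schur_scalar π ⟨v₀, hv₀⟩ hirr (I ∘ₗ I') (fun g v => by simp [h1', hIg, hσ])
    have hI' : ∀ v, I' v = e • I v := fun v => by
      rw [← hII (I' v), ← map_smul]
      exact congrArg I (he v)
    have hee : (e * e - 1) • v₀ = 0 := by
      have h := h2' v₀
      rw [hI', hI', map_smul, hII, smul_smul] at h
      rw [sub_smul, h, one_smul, sub_self]
    have hee' : e * e = 1 := sub_eq_zero.1 ((smul_eq_zero.1 hee).resolve_right hv₀)
    rcases mul_self_eq_one_iff.1 hee' with rfl | rfl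
    · left; ext v; simp [hI']
    · right; ext v; simp [hI']
end

section
/- Let G be a group, U a subgroup of G, and ψ : U → ℂ^× a group homomorphism. Let f : G → ℂ be a function satisfying f(u₁ g u₂) = ψ(u₁) ψ(u₂) f(g) for all u₁, u₂ ∈ U and g ∈ G. If g ∈ G is such that there exists u ∈ U with g u g⁻¹ ∈ U and ψ(g u g⁻¹) ≠ ψ(u), then f(g) = 0. -/
/-- Let `G` be a group, `U` a subgroup and `ψ : U → ℂˣ` a homomorphism. If
`f : G → ℂ` satisfies `f(u₁ g u₂) = ψ(u₁) ψ(u₂) f(g)` and `g ∈ G` is such that some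
`u ∈ U` has `g u g⁻¹ ∈ U` with `ψ(g u g⁻¹) ≠ ψ(u)`, then `f(g) = 0`. -/
theorem stmt6 {G : Type*} [Group G] (U : Subgroup G) (ψ : U →* ℂˣ)
    (f : G → ℂ)
    (hf : ∀ (u₁ u₂ : U) (g : G),
      f (↑u₁ * g * ↑u₂) = (ψ u₁ : ℂ) * (ψ u₂ : ℂ) * f g)
    (g : G) (u : U) (hmem : g * ↑u * g⁻¹ ∈ U)
    (hne : ψ ⟨g * ↑u * g⁻¹, hmem⟩ ≠ ψ u) :
    f g = 0 := by
  have h1 := hf ⟨g * ↑u * g⁻¹, hmem⟩ 1 g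
  have h2 := hf 1 u g
  simp only [map_one, Units.val_one, OneMemClass.coe_one, mul_one, one_mul,
    inv_mul_cancel_right] at h1 h2
  by_contra h0
  exact hne (Units.ext (mul_right_cancel₀ h0 (h1.symm.trans h2)))
end

section
/- Let G be a group, U a subgroup of G, and ψ : U → ℂ^× a group homomorphism. Let n ∈ G be an element such that for every u ∈ U: if n u n⁻¹ ∈ U then ψ(n u n⁻¹) = ψ(u), and if n⁻¹ u n ∈ U then ψ(n⁻¹ u n) = ψ(u). Then there exists a function f : G → ℂ, supported on the double coset U n U, such that f(u₁ n u₂) = ψ(u₁) ψ(u₂) for all u₁, u₂ ∈ U. In particular, f is (U, ψ)-bi-equivariant, i.e. f(u₁ g u₂) = ψ(u₁) ψ(u₂) f(g) for all u₁, u₂ ∈ U and g ∈ G, and f(n) = 1, so f is not identically zero. -/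
/-- Let `G` be a group, `U` a subgroup and `ψ : U → ℂˣ` a homomorphism. Let `n ∈ G` be
such that conjugation by `n` (in either direction), whenever it maps an element of `U`
into `U`, preserves `ψ`. Then there exists an `(U, ψ)`-bi-equivariant function `f : G → ℂ`
supported on the double coset `U n U` with `f(u₁ n u₂) = ψ(u₁) ψ(u₂)`; in particular
`f(n) = 1`, so `f` is not identically zero. -/
theorem stmt7 {G : Type*} [Group G] (U : Subgroup G) (ψ : U →* ℂˣ)
    (n : G)
    (h₁ : ∀ (u : U) (h : n * ↑u * n⁻¹ ∈ U), ψ ⟨n * ↑u * n⁻¹, h⟩ = ψ u)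
    (h₂ : ∀ (u : U) (h : n⁻¹ * ↑u * n ∈ U), ψ ⟨n⁻¹ * ↑u * n, h⟩ = ψ u) :
    ∃ f : G → ℂ,
      (∀ g : G, f g ≠ 0 → ∃ u₁ u₂ : U, g = ↑u₁ * n * ↑u₂) ∧
      (∀ u₁ u₂ : U, f (↑u₁ * n * ↑u₂) = (ψ u₁ : ℂ) * (ψ u₂ : ℂ)) ∧
      (∀ (u₁ u₂ : U) (g : G),
        f (↑u₁ * g * ↑u₂) = (ψ u₁ : ℂ) * (ψ u₂ : ℂ) * f g) ∧
      f n = 1 := by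
  classical
  have key : ∀ a b c d : U, (a : G) * n * b = c * n * d → ψ a * ψ b = ψ c * ψ d := by
    intro a b c d h
    have e : n * ((d * b⁻¹ : U) : G) * n⁻¹ = ((c⁻¹ * a : U) : G) := by
      push_cast
      have h' : (a : G) = c * n * d * (b : G)⁻¹ * n⁻¹ := by
        rw [← h]; group
      rw [h']; group
    have hm : n * ((d * b⁻¹ : U) : G) * n⁻¹ ∈ U := by
      rw [e]; exact (c⁻¹ * a : U).2
    have h3 := h₁ (d * b⁻¹) hm
    have h4 : (⟨n * ((d * b⁻¹ : U) : G) * n⁻¹, hm⟩ : U) = c⁻¹ * a := Subtype.ext e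
    rw [h4, map_mul, map_mul, map_inv, map_inv, inv_mul_eq_iff_eq_mul] at h3
    rw [h3]
    simp [mul_assoc]
  let f : G → ℂ := fun g =>
    if h : ∃ p : U × U, g = (p.1 : G) * n * p.2 then
      ((ψ h.choose.1 * ψ h.choose.2 : ℂˣ) : ℂ) else 0
  have hf : ∀ u₁ u₂ : U, f (↑u₁ * n * ↑u₂) = (ψ u₁ : ℂ) * (ψ u₂ : ℂ) := by
    intro a b
    have h : ∃ p : U × U, (a : G) * n * b = (p.1 : G) * n * p.2 := ⟨(a, b), rfl⟩
    simp only [f]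
    rw [dif_pos h, ← key _ _ _ _ h.choose_spec, Units.val_mul]
  have hs : ∀ g : G, f g ≠ 0 → ∃ u₁ u₂ : U, g = ↑u₁ * n * ↑u₂ := by
    intro g hg
    by_contra hc
    apply hg
    simp only [f]
    rw [dif_neg]
    rintro ⟨p, hp⟩
    exact hc ⟨p.1, p.2, hp⟩
  refine ⟨f, hs, hf, ?_, ?_⟩
  · intro a b g
    by_cases hg : ∃ u₁ u₂ : U, g = ↑u₁ * n * ↑u₂
    · obtain ⟨c, d, rfl⟩ := hg
      have e : (a : G) * (c * n * d) * b = ((a * c : U) : G) * n * ((d * b : U) : G) := by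
        push_cast; group
      rw [e, hf, hf]
      simp only [map_mul, Units.val_mul]
      ring
    · have h0 : f g = 0 := by
        by_contra h
        exact hg (hs g h)
      rw [h0, mul_zero]
      by_contra h
      obtain ⟨c, d, hcd⟩ := hs _ h
      refine hg ⟨a⁻¹ * c, d * b⁻¹, ?_⟩
      have e : g = (a : G)⁻¹ * (a * g * b) * (b : G)⁻¹ := by group
      rw [e, hcd]
      push_cast; group
  · have := hf 1 1
    simpa using this
end

section
/- Let G be a finite group, H a subgroup of G, χ, χ' : H → ℂ^× group homomorphisms, and ι : G → G a group automorphism. Assume the following Gelfand-type condition: every function B : G → ℂ satisfying B(h₁ g h₂) = χ(h₁) χ'(h₂) B(g) for all h₁, h₂ ∈ H and g ∈ G also satisfies B(ι(g⁻¹)) = B(g) for all g ∈ G. Let (π, V) be an irreducible finite-dimensional complex representation of G admitting a nonzero vector ξ ∈ V with π(h) ξ = χ'(h) · ξ for all h ∈ H, and a nonzero linear functional l : V → ℂ with l(π(h) w) = χ(h) · l(w) for all h ∈ H and w ∈ V. Then π ∘ ι is isomorphic to the contragredient representation π^∨ of π. -/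
/-- Gelfand-type criterion: let `G` be a finite group, `H ≤ G`, `χ, χ' : H → ℂˣ`
homomorphisms, and `ι` an automorphism of `G` such that every `(H,χ)–(H,χ')`-equivariant
function `B : G → ℂ` (i.e. `B(h₁ g h₂) = χ(h₁) χ'(h₂) B(g)`) satisfies
`B(ι(g⁻¹)) = B(g)`. If an irreducible finite-dimensional complex representation `π` of `G`
has a nonzero vector `ξ` with `π(h) ξ = χ'(h) ξ` and a nonzero linear functional `l` with
`l(π(h) w) = χ(h) l(w)`, then `π ∘ ι` is isomorphic to the contragredient `π^∨`
(Mathlib's `π.dual`, acting by `(π^∨(g) φ)(w) = φ(π(g⁻¹) w)`). -/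
theorem stmt10 {G : Type*} [Group G] [Finite G] (H : Subgroup G)
    (χ χ' : H →* ℂˣ) (ι : G ≃* G)
    (hGelfand : ∀ B : G → ℂ,
      (∀ (h₁ h₂ : H) (g : G),
        B (↑h₁ * g * ↑h₂) = (χ h₁ : ℂ) * (χ' h₂ : ℂ) * B g) →
      ∀ g : G, B (ι g⁻¹) = B g)
    {V : Type*} [AddCommGroup V] [Module ℂ V] [FiniteDimensional ℂ V]
    (π : Representation ℂ G V)
    (hirr : ∀ W : Submodule ℂ V, (∀ g : G, ∀ w ∈ W, π g w ∈ W) → W = ⊥ ∨ W = ⊤)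
    (ξ : V) (hξ : ξ ≠ 0)
    (hξH : ∀ h : H, π (↑h : G) ξ = (χ' h : ℂ) • ξ)
    (l : Module.Dual ℂ V) (hl : l ≠ 0)
    (hlH : ∀ (h : H) (w : V), l (π (↑h : G) w) = (χ h : ℂ) * l w) :
    ∃ T : V ≃ₗ[ℂ] Module.Dual ℂ V,
      ∀ (g : G) (w : V), T (π (ι g) w) = π.dual g (T w) := by
  have hB : ∀ g : G, l (π (ι g⁻¹) ξ) = l (π g ξ) := by
    apply hGelfand (fun g => l (π g ξ))
    intro h₁ h₂ g
    simp only [map_mul, Module.End.mul_apply, hlH, hξH, map_smul, smul_eq_mul]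
    ring
  set P := Finsupp.linearCombination ℂ (fun g : G => π (ι g) ξ) with hP
  set Q := Finsupp.linearCombination ℂ (fun g : G => π.dual g l) with hQ
  have key : ∀ (z : G) (c : G →₀ ℂ), Q c (π z ξ) = l (π (ι z⁻¹) (P c)) := by
    intro z c
    induction c using Finsupp.induction_linear with
    | zero => simp
    | add a b ha hb => simp only [map_add, LinearMap.add_apply, ha, hb]
    | single g a =>
      have h := hB (g⁻¹ * z)
      simp only [mul_inv_rev, inv_inv, map_mul, Module.End.mul_apply] at h
      simp only [hP, hQ, Finsupp.linearCombination_single, LinearMap.smul_apply, map_smul,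
        Representation.dual_apply, Module.Dual.transpose_apply, LinearMap.comp_apply]
      rw [h]
  -- `ξ` generates the space
  have hcyc : Submodule.span ℂ (Set.range fun g : G => π g ξ) = ⊤ := by
    refine (hirr _ ?_).resolve_left ?_
    · intro g w hw
      have hle : Submodule.span ℂ (Set.range fun g : G => π g ξ) ≤
          (Submodule.span ℂ (Set.range fun g : G => π g ξ)).comap (π g) := by
        rw [Submodule.span_le]
        rintro _ ⟨x, rfl⟩
        refine Submodule.subset_span ⟨g * x, ?_⟩
        simp
      exact hle hw
    · intro h
      have h1 : ξ ∈ Submodule.span ℂ (Set.range fun g : G => π g ξ) :=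
        Submodule.subset_span ⟨1, by simp⟩
      rw [h] at h1
      exact hξ (by simpa using h1)
  have hPsurj : Function.Surjective P := by
    rw [← LinearMap.range_eq_top, hP, Finsupp.range_linearCombination, ← hcyc]
    congr 1
    exact ι.surjective.range_comp (fun g : G => π g ξ)
  have hPQ : ∀ c, P c = 0 → Q c = 0 := by
    intro c hc
    refine LinearMap.ext_on_range hcyc ?_
    intro z
    rw [key, hc]
    simp
  have hQP : ∀ c, Q c = 0 → P c = 0 := by
    intro c hc
    let W : Submodule ℂ V := ⨅ x : G, LinearMap.ker (l ∘ₗ π x)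
    have hW : ∀ v, v ∈ W ↔ ∀ x : G, l (π x v) = 0 := by
      intro v
      simp [W, Submodule.mem_iInf]
    have hbot : W = ⊥ := by
      refine (hirr W ?_).resolve_right ?_
      · intro g w hw
        rw [hW] at hw ⊢
        intro x
        have := hw (x * g)
        simpa using this
      · intro h
        apply hl
        ext v
        have hv : v ∈ W := by rw [h]; trivial
        simpa using (hW v).1 hv 1
    have hm : P c ∈ W := by
      rw [hW]
      intro x
      have := key (ι.symm x)⁻¹ c
      rw [hc] at this
      simpa using this.symm
    rw [hbot] at hm
    simpa using hm
  obtain ⟨s, hs⟩ := P.exists_rightInverse_of_surjective (LinearMap.range_eq_top.2 hPsurj)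
  have hs' : ∀ v, P (s v) = v := fun v => LinearMap.congr_fun hs v
  have hT : ∀ c, Q (s (P c)) = Q c := by
    intro c
    have := hPQ (s (P c) - c) (by rw [map_sub, hs', sub_self])
    rwa [map_sub, sub_eq_zero] at this
  have hinj : Function.Injective (Q ∘ₗ s) := by
    rw [injective_iff_map_eq_zero]
    intro v hv
    have := hQP (s v) hv
    rwa [hs'] at this
  refine ⟨LinearEquiv.ofInjectiveOfFinrankEq (Q ∘ₗ s) hinj Subspace.dual_finrank_eq.symm, ?_⟩
  intro g w
  change Q (s (π (ι g) w)) = π.dual g (Q (s w))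
  obtain ⟨c, rfl⟩ := hPsurj w
  rw [hT]
  induction c using Finsupp.induction_linear with
  | zero => simp
  | add a b ha hb => simp only [map_add, ha, hb]
  | single x a =>
    have h1 : π (ι g) (P (Finsupp.single x a)) = P (Finsupp.single (g * x) a) := by
      simp [hP, Finsupp.linearCombination_single]
    rw [h1, hT]
    simp only [hQ, Finsupp.linearCombination_single, map_smul, map_mul, Module.End.mul_apply]
end
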